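/- Let h be a complex Laurent polynomial, i.e. h(z) = ∑_{j} c_j z^j with only finitely many nonzero coefficients c_j ∈ ℂ (j ∈ ℤ), not all zero. If ‖h(z)‖ = 1 for all z ∈ ℂ with ‖z‖ = 1, then there exist c ∈ ℂ with ‖c‖ = 1 and m ∈ ℤ such that h(z) = c · z^m for all z with ‖z‖ = 1. -/

import Mathlib

lemma aux_infinite_circle : Set.Infinite {z : ℂ | ‖z‖ = 1} := by
  have h : IsPreconnected (Metric.sphere (0:ℂ) 1) :=
    isPreconnected_sphere (by simp [Complex.rank_real_complex]) 0 1
  have h2 : (Metric.sphere (0:ℂ) 1).Infinite := by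
    apply h.infinite_of_nontrivial
    refine ⟨1, by simp, -1, by simp, ?_⟩
    norm_num
  convert h2 using 1
  ext z; simp

/-- A nonzero complex Laurent polynomial that is unimodular on the unit
circle agrees on the unit circle with `c • z^m` for some unimodular constant `c` and some
integer `m`. -/
theorem laurent_unimodular_eq_monomial
    (s : Finset ℤ) (c : ℤ → ℂ) (hne : ∃ j ∈ s, c j ≠ 0)
    (h1 : ∀ z : ℂ, ‖z‖ = 1 → ‖∑ j ∈ s, c j * z ^ j‖ = 1) :
    ∃ (a : ℂ) (m : ℤ), ‖a‖ = 1 ∧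
      ∀ z : ℂ, ‖z‖ = 1 → ∑ j ∈ s, c j * z ^ j = a * z ^ m := by
  obtain ⟨N, hN⟩ : ∃ N : ℕ, ∀ j ∈ s, j.natAbs ≤ N :=
    ⟨s.sup Int.natAbs, fun j hj => Finset.le_sup (f := Int.natAbs) hj⟩
  let P : Polynomial ℂ := ∑ j ∈ s, Polynomial.C (c j) * Polynomial.X ^ (j + N).toNat
  let Q : Polynomial ℂ :=
    ∑ j ∈ s, Polynomial.C ((starRingEnd ℂ) (c j)) * Polynomial.X ^ (N - j).toNat
  have hP : ∀ z : ℂ, ‖z‖ = 1 → P.eval z = (∑ j ∈ s, c j * z ^ j) * z ^ N := by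
    intro z hz
    have hz0 : z ≠ 0 := by rintro rfl; simp at hz
    simp only [P, Polynomial.eval_finset_sum, Finset.sum_mul]
    refine Finset.sum_congr rfl fun j hj => ?_
    have := hN j hj
    have h0 : ((j + N).toNat : ℤ) = j + N := by omega
    simp only [Polynomial.eval_mul, Polynomial.eval_C, Polynomial.eval_pow, Polynomial.eval_X]
    rw [← zpow_natCast z (j + N).toNat, h0, zpow_add₀ hz0, zpow_natCast, mul_assoc]
  have hQ : ∀ z : ℂ, ‖z‖ = 1 →
      Q.eval z = (starRingEnd ℂ) (∑ j ∈ s, c j * z ^ j) * z ^ N := by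
    intro z hz
    have hz0 : z ≠ 0 := by rintro rfl; simp at hz
    have hc : (starRingEnd ℂ) z = z⁻¹ := (Complex.inv_eq_conj hz).symm
    simp only [Q, Polynomial.eval_finset_sum, map_sum, Finset.sum_mul]
    refine Finset.sum_congr rfl fun j hj => ?_
    have := hN j hj
    have h0 : ((N - j).toNat : ℤ) = -j + N := by omega
    simp only [Polynomial.eval_mul, Polynomial.eval_C, Polynomial.eval_pow, Polynomial.eval_X]
    rw [← zpow_natCast z (N - j).toNat, h0, zpow_add₀ hz0, zpow_natCast, map_mul, map_zpow₀, hc,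
      inv_zpow', mul_assoc]
  have hPQ : P * Q = Polynomial.X ^ (2 * N) := by
    apply Polynomial.eq_of_infinite_eval_eq
    refine aux_infinite_circle.mono fun z hz => ?_
    have hz : ‖z‖ = 1 := hz
    have h2 := Complex.mul_conj' (∑ j ∈ s, c j * z ^ j)
    rw [h1 z hz] at h2
    simp only [Set.mem_setOf_eq, Polynomial.eval_mul, Polynomial.eval_pow, Polynomial.eval_X]
    rw [hP z hz, hQ z hz, mul_mul_mul_comm, h2]
    push_cast
    ring
  obtain ⟨k, -, hk⟩ := (dvd_prime_pow Polynomial.prime_X _).1 (Dvd.intro _ hPQ)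
  obtain ⟨u, hu⟩ := hk.symm
  obtain ⟨a, -, ha⟩ := Polynomial.isUnit_iff.1 u.isUnit
  have key : ∀ z : ℂ, ‖z‖ = 1 → ∑ j ∈ s, c j * z ^ j = a * z ^ ((k : ℤ) - N) := by
    intro z hz
    have hz0 : z ≠ 0 := by rintro rfl; simp at hz
    have h3 := hP z hz
    rw [← hu, ← ha] at h3
    simp only [Polynomial.eval_mul, Polynomial.eval_C, Polynomial.eval_pow,
      Polynomial.eval_X] at h3
    rw [zpow_sub₀ hz0, zpow_natCast, zpow_natCast, ← mul_div_assoc,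
      eq_div_iff (pow_ne_zero _ hz0), ← h3, mul_comm]
  refine ⟨a, k - N, ?_, key⟩
  have h4 := h1 1 (by simp)
  rw [key 1 (by simp)] at h4
  simpa using h4
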